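/- Under the hypotheses of the RK-RRK convergence theorem (A ∈ ℝ^{m×ℓ}, B ∈ ℝ^{ℓ×n}, rank(A) = rank(B) = ℓ, b ∈ ran(AB), f : ℝ^n → ℝ γ-strongly convex with differentiable conjugate, x⋆ the unique solution of: minimize f(x) subject to ABx = b, and ν > 0 with D_{f,z}(x, x⋆) ≤ (1/ν)‖B(x − x⋆)‖₂² for all x and z ∈ ∂f(x) ∩ ran(Bᵀ)), set α = 1 − σ_min²(A)/‖A‖_F², β = 1 − γν/(2‖B‖_F²), and ρ = max{α, β}. Then for every δ > 0 with (1 + δ/γ)ρ < 1 and every k ≥ 1, the RK-RRK iterates satisfy E[‖x^{(k)} − x⋆‖₂²] ≤ (1 + δ/γ)^k ρ^k (2/γ) ( D_{f,z^{(0)}}(x^{(0)}, x⋆) + ((δ+γ)γ²/(2δ²‖B‖_F²)) ‖A†b‖₂² ); in particular the RK-RRK algorithm converges linearly in expectation to x⋆ with rate (1 + δ/γ)ρ. -/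

import Mathlib

open Finset

noncomputable section

/-- Euclidean inner product on `ℝ^k`. -/
def dotp {k : ℕ} (x y : Fin k → ℝ) : ℝ := ∑ i, x i * y i

/-- Squared Euclidean norm on `ℝ^k`. -/
def sqnorm {k : ℕ} (x : Fin k → ℝ) : ℝ := ∑ i, (x i) ^ 2

/-- Subdifferential of `f` at `x`. -/
def subdiff {k : ℕ} (f : (Fin k → ℝ) → ℝ) (x : Fin k → ℝ) : Set (Fin k → ℝ) :=
  {z | ∀ y, f y ≥ f x + dotp z (y - x)}

/-- `f` is `γ`-strongly convex. -/
def StrongConvexWith {k : ℕ} (γ : ℝ) (f : (Fin k → ℝ) → ℝ) : Prop :=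
  ∀ x y z, z ∈ subdiff f x → f y ≥ f x + dotp z (y - x) + γ / 2 * sqnorm (y - x)

/-- Bregman distance between `x` and `y` with respect to `f` and `z ∈ ∂f(x)`. -/
def Dbreg {k : ℕ} (f : (Fin k → ℝ) → ℝ) (z x y : Fin k → ℝ) : ℝ :=
  f y - f x - dotp z (y - x)

open Matrix

/-- Squared Frobenius norm of a matrix. -/
def frobSq {m l : ℕ} (A : Matrix (Fin m) (Fin l) ℝ) : ℝ := ∑ i, ∑ j, (A i j) ^ 2

/-- Square of the minimum singular value of a (full column rank) matrix. -/
def sminSq {m l : ℕ} (A : Matrix (Fin m) (Fin l) ℝ) : ℝ :=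
  sInf {c : ℝ | ∃ v : Fin l → ℝ, sqnorm v = 1 ∧ c = sqnorm (A.mulVec v)}

/-- `P` is the Moore–Penrose pseudoinverse of `A` (Penrose conditions). -/
def IsMoorePenrose {m l : ℕ} (A : Matrix (Fin m) (Fin l) ℝ)
    (P : Matrix (Fin l) (Fin m) ℝ) : Prop :=
  A * P * A = A ∧ P * A * P = P ∧ (A * P)ᵀ = A * P ∧ (P * A)ᵀ = P * A

/-- One step of the RK-RRK algorithm: given the choice `c = (j, i)` of a row of `A`
and a row of `B`, and the current state `s = (y, z)`, perform one RK step for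
`A y = b` followed by one RRK step for `B x = y` (with `x = Df z`). -/
def rkrrkStep {m l n : ℕ} (A : Matrix (Fin m) (Fin l) ℝ) (B : Matrix (Fin l) (Fin n) ℝ)
    (b : Fin m → ℝ) (γ : ℝ) (Df : (Fin n → ℝ) → (Fin n → ℝ)) (c : Fin m × Fin l)
    (s : (Fin l → ℝ) × (Fin n → ℝ)) : (Fin l → ℝ) × (Fin n → ℝ) :=
  let y' := s.1 - ((dotp (A c.1) s.1 - b c.1) / sqnorm (A c.1)) • A c.1
  (y', s.2 - (γ * (dotp (B c.2) (Df s.2) - y' c.2) / sqnorm (B c.2)) • B c.2)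

/-- The RK-RRK iterate obtained from initial state `(y0, z0)` by applying one
step for each entry of the list of index choices. -/
def rkrrkIter {m l n : ℕ} (A : Matrix (Fin m) (Fin l) ℝ) (B : Matrix (Fin l) (Fin n) ℝ)
    (b : Fin m → ℝ) (γ : ℝ) (Df : (Fin n → ℝ) → (Fin n → ℝ))
    (y0 : Fin l → ℝ) (z0 : Fin n → ℝ) :
    List (Fin m × Fin l) → (Fin l → ℝ) × (Fin n → ℝ)
  | [] => (y0, z0)
  | c :: cs => rkrrkStep A B b γ Df c (rkrrkIter A B b γ Df y0 z0 cs)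

lemma dotp_eq_dotProduct {k : ℕ} (x y : Fin k → ℝ) : dotp x y = x ⬝ᵥ y := rfl

lemma sqnorm_eq_dotProduct {k : ℕ} (x : Fin k → ℝ) : sqnorm x = x ⬝ᵥ x := by
  simp [sqnorm, dotProduct, sq]

lemma sqnorm_nonneg {k : ℕ} (x : Fin k → ℝ) : 0 ≤ sqnorm x :=
  Finset.sum_nonneg fun _ _ => sq_nonneg _

lemma sqnorm_eq_zero {k : ℕ} {x : Fin k → ℝ} (h : sqnorm x = 0) : x = 0 := by
  rwa [sqnorm_eq_dotProduct, dotProduct_self_eq_zero] at h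

lemma sqnorm_smul {k : ℕ} (c : ℝ) (x : Fin k → ℝ) : sqnorm (c • x) = c ^ 2 * sqnorm x := by
  simp only [sqnorm_eq_dotProduct, smul_dotProduct, dotProduct_smul, smul_eq_mul]
  ring

lemma sqnorm_sub_smul {k : ℕ} (c : ℝ) (x y : Fin k → ℝ) :
    sqnorm (x - c • y) = sqnorm x - 2 * c * dotp y x + c ^ 2 * sqnorm y := by
  simp only [sqnorm, dotp, Finset.mul_sum, ← Finset.sum_sub_distrib, ← Finset.sum_add_distrib]
  refine Finset.sum_congr rfl fun i _ => ?_
  rw [Pi.sub_apply, Pi.smul_apply, smul_eq_mul]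
  ring

lemma frobSq_eq_sum_sqnorm {m l : ℕ} (A : Matrix (Fin m) (Fin l) ℝ) :
    frobSq A = ∑ i, sqnorm (A i) := rfl

lemma frobSq_nonneg {m l : ℕ} (A : Matrix (Fin m) (Fin l) ℝ) : 0 ≤ frobSq A :=
  Finset.sum_nonneg fun i _ => sqnorm_nonneg (A i)

lemma frobSq_pos {m l : ℕ} (A : Matrix (Fin m) (Fin l) ℝ) (h : A ≠ 0) : 0 < frobSq A := by
  refine lt_of_le_of_ne (frobSq_nonneg A) fun h0 => h ?_
  rw [frobSq_eq_sum_sqnorm, eq_comm,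
    Finset.sum_eq_zero_iff_of_nonneg fun i _ => sqnorm_nonneg (A i)] at h0
  funext i
  exact sqnorm_eq_zero (h0 i (Finset.mem_univ i))

lemma ne_zero_of_rank_pos {m l : ℕ} (A : Matrix (Fin m) (Fin l) ℝ) (h : 0 < A.rank) :
    A ≠ 0 := by
  rintro rfl
  simp at h

lemma mulVec_injective_of_rank_eq {m l : ℕ} (A : Matrix (Fin m) (Fin l) ℝ) (h : A.rank = l) :
    Function.Injective A.mulVec := by
  rw [Matrix.mulVec_injective_iff, linearIndependent_iff_card_eq_finrank_span,
    Set.finrank, ← Matrix.rank_eq_finrank_span_cols, h, Fintype.card_fin]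

lemma sminSq_mul_sqnorm_le {m l : ℕ} (A : Matrix (Fin m) (Fin l) ℝ) (v : Fin l → ℝ) :
    sminSq A * sqnorm v ≤ sqnorm (A.mulVec v) := by
  rcases (sqnorm_nonneg v).eq_or_lt with h | h
  · rw [← h, mul_zero]
    exact sqnorm_nonneg _
  · have hs : (√(sqnorm v))⁻¹ ^ 2 = (sqnorm v)⁻¹ := by
      rw [inv_pow, Real.sq_sqrt h.le]
    have hle : sminSq A ≤ (sqnorm v)⁻¹ * sqnorm (A.mulVec v) := by
      refine csInf_le ⟨0, ?_⟩ ⟨(√(sqnorm v))⁻¹ • v, ?_, ?_⟩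
      · rintro c ⟨w, -, rfl⟩
        exact sqnorm_nonneg _
      · rw [sqnorm_smul, hs, inv_mul_cancel₀ h.ne']
      · rw [Matrix.mulVec_smul, sqnorm_smul, hs]
    calc sminSq A * sqnorm v ≤ (sqnorm v)⁻¹ * sqnorm (A.mulVec v) * sqnorm v := by gcongr
      _ = sqnorm (A.mulVec v) := by field_simp

/-- Expected squared error after one randomized Kaczmarz step. -/
lemma sum_sqnorm_kaczmarz_step_le {m l : ℕ} (A : Matrix (Fin m) (Fin l) ℝ) (hA : 0 < frobSq A)
    (y ystar : Fin l → ℝ) :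
    ∑ j, sqnorm (A j) / frobSq A *
        sqnorm (y - ((dotp (A j) y - A.mulVec ystar j) / sqnorm (A j)) • A j - ystar)
      ≤ (1 - sminSq A / frobSq A) * sqnorm (y - ystar) := by
  have hrow (j : Fin m) : sqnorm (A j) / frobSq A *
      sqnorm (y - ((dotp (A j) y - A.mulVec ystar j) / sqnorm (A j)) • A j - ystar)
      = sqnorm (A j) * (sqnorm (y - ystar) / frobSq A)
        - A.mulVec (y - ystar) j ^ 2 / frobSq A := by
    have hr : dotp (A j) y - A.mulVec ystar j = A.mulVec (y - ystar) j := by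
      rw [Matrix.mulVec_sub]; rfl
    rw [hr]
    rcases eq_or_ne (sqnorm (A j)) 0 with h | h
    · have h0 : A.mulVec (y - ystar) j = 0 := by
        rw [Matrix.mulVec, sqnorm_eq_zero h, zero_dotProduct]
      simp [h, h0]
    · have hd : A.mulVec (y - ystar) j = A j ⬝ᵥ (y - ystar) := rfl
      set r := A.mulVec (y - ystar) j
      have he : y - (r / sqnorm (A j)) • A j - ystar
          = (y - ystar) - (r / sqnorm (A j)) • A j := by abel
      have hn : sqnorm ((y - ystar) - (r / sqnorm (A j)) • A j)
          = sqnorm (y - ystar) - r ^ 2 / sqnorm (A j) := by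
        rw [sqnorm_sub_smul, dotp_eq_dotProduct, ← hd]
        field_simp
        ring
      rw [he, hn]
      field_simp
  rw [Finset.sum_congr rfl fun j _ => hrow j, Finset.sum_sub_distrib, ← Finset.sum_mul,
    ← frobSq_eq_sum_sqnorm, ← Finset.sum_div]
  change _ - sqnorm (A.mulVec (y - ystar)) / frobSq A ≤ _
  have := div_le_div_of_nonneg_right (sminSq_mul_sqnorm_le A (y - ystar)) hA.le
  rw [mul_div_cancel₀ _ hA.ne', sub_mul, one_mul, div_mul_eq_mul_div]
  linarith

lemma sminSq_div_frobSq_le_one {m l : ℕ} (A : Matrix (Fin m) (Fin l) ℝ) (hA : 0 < frobSq A)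
    (hl : 0 < l) : sminSq A / frobSq A ≤ 1 := by
  have h := sum_sqnorm_kaczmarz_step_le A hA (Pi.single ⟨0, hl⟩ 1) 0
  have h0 := (Finset.sum_nonneg fun j _ => mul_nonneg
    (div_nonneg (sqnorm_nonneg (A j)) hA.le) (sqnorm_nonneg _)).trans h
  have h1 : sqnorm (Pi.single (⟨0, hl⟩ : Fin l) (1 : ℝ) - 0) = 1 := by
    simp [sqnorm_eq_dotProduct]
  rw [h1] at h0
  linarith

lemma Dbreg_nonneg {n : ℕ} {f : (Fin n → ℝ) → ℝ} {x z : Fin n → ℝ} (hz : z ∈ subdiff f x)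
    (y : Fin n → ℝ) : 0 ≤ Dbreg f z x y := by
  have := hz y
  unfold Dbreg
  linarith

lemma sqnorm_sub_le_Dbreg {n : ℕ} {f : (Fin n → ℝ) → ℝ} {γ : ℝ} (hγ : 0 < γ)
    (hsc : StrongConvexWith γ f) {x z : Fin n → ℝ} (hz : z ∈ subdiff f x) (y : Fin n → ℝ) :
    sqnorm (x - y) ≤ 2 / γ * Dbreg f z x y := by
  have h := hsc x y z hz
  have hs : sqnorm (x - y) = sqnorm (y - x) := by
    simp only [sqnorm, Pi.sub_apply, sub_sq_comm]
  rw [hs, Dbreg, div_mul_eq_mul_div, le_div_iff₀ hγ]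
  linarith

/-- Change of the Bregman distance under a change of subgradient: the `1/γ`-smoothness of the
conjugate of a `γ`-strongly convex function. -/
lemma Dbreg_le_add {n : ℕ} {f : (Fin n → ℝ) → ℝ} {γ : ℝ} (hγ : 0 < γ)
    (hsc : StrongConvexWith γ f) {x z : Fin n → ℝ} (hz : z ∈ subdiff f x)
    (x' z' w : Fin n → ℝ) :
    Dbreg f z' x' w
      ≤ Dbreg f z x w + dotp (z' - z) (x - w) + sqnorm (z' - z) / (2 * γ) := by
  have h := hsc x x' z hz
  have hq : 0 ≤ sqnorm ((z' - z) - γ • (x' - x)) / (2 * γ) :=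
    div_nonneg (sqnorm_nonneg _) (by positivity)
  have he : sqnorm ((z' - z) - γ • (x' - x)) / (2 * γ)
      = sqnorm (z' - z) / (2 * γ) - dotp (z' - z) (x' - x) + γ / 2 * sqnorm (x' - x) := by
    rw [sqnorm_sub_smul, dotp_eq_dotProduct, dotp_eq_dotProduct, dotProduct_comm (x' - x)]
    field_simp
  simp only [Dbreg, dotp_eq_dotProduct, sub_dotProduct, dotProduct_sub] at *
  linarith

/-- Expected Bregman distance after one relaxed step with inexact right-hand side `y`. -/
lemma sum_Dbreg_step_le {l n : ℕ} (B : Matrix (Fin l) (Fin n) ℝ) (hB : 0 < frobSq B)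
    {f : (Fin n → ℝ) → ℝ} {γ : ℝ} (hγ : 0 < γ) (hsc : StrongConvexWith γ f)
    (Df : (Fin n → ℝ) → (Fin n → ℝ)) (hDf : ∀ x z, z ∈ subdiff f x ↔ x = Df z)
    (w z : Fin n → ℝ) (y : Fin l → ℝ) :
    ∑ i, sqnorm (B i) / frobSq B *
        Dbreg f (z - (γ * (dotp (B i) (Df z) - y i) / sqnorm (B i)) • B i)
          (Df (z - (γ * (dotp (B i) (Df z) - y i) / sqnorm (B i)) • B i)) w
      ≤ Dbreg f z (Df z) w - γ / (2 * frobSq B) * sqnorm (B.mulVec (Df z - w))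
        + γ / (2 * frobSq B) * sqnorm (y - B.mulVec w) := by
  have hrow (i : Fin l) : sqnorm (B i) / frobSq B *
        Dbreg f (z - (γ * (dotp (B i) (Df z) - y i) / sqnorm (B i)) • B i)
          (Df (z - (γ * (dotp (B i) (Df z) - y i) / sqnorm (B i)) • B i)) w
      ≤ sqnorm (B i) * (Dbreg f z (Df z) w / frobSq B)
        - γ / (2 * frobSq B) * B.mulVec (Df z - w) i ^ 2
        + γ / (2 * frobSq B) * (y - B.mulVec w) i ^ 2 := by
    have hd : B.mulVec (Df z - w) i = B i ⬝ᵥ (Df z - w) := rfl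
    rcases eq_or_ne (sqnorm (B i)) 0 with h | h
    · rw [hd, sqnorm_eq_zero h, zero_dotProduct]
      have : 0 ≤ γ / (2 * frobSq B) * (y - B.mulVec w) i ^ 2 := by positivity
      simpa [sqnorm] using this
    · have hpos : 0 < sqnorm (B i) := lt_of_le_of_ne (sqnorm_nonneg _) h.symm
      have hr : dotp (B i) (Df z) - y i = B.mulVec (Df z - w) i - (y - B.mulVec w) i := by
        rw [Matrix.mulVec_sub, Pi.sub_apply, Pi.sub_apply]
        change _ = (dotp (B i) (Df z) - _) - _
        ring
      rw [hr]
      set u := B.mulVec (Df z - w) i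
      set v := (y - B.mulVec w) i
      have hD := Dbreg_le_add hγ hsc ((hDf (Df z) z).2 rfl)
        (Df (z - (γ * (u - v) / sqnorm (B i)) • B i)) (z - (γ * (u - v) / sqnorm (B i)) • B i) w
      have hz : z - (γ * (u - v) / sqnorm (B i)) • B i - z
          = (-(γ * (u - v) / sqnorm (B i))) • B i := by
        rw [neg_smul]; abel
      rw [hz, sqnorm_smul, dotp_eq_dotProduct, smul_dotProduct, ← hd, smul_eq_mul] at hD
      refine (mul_le_mul_of_nonneg_left hD (by positivity)).trans (le_of_eq ?_)
      field_simp
      ring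
  refine (Finset.sum_le_sum fun i _ => hrow i).trans (le_of_eq ?_)
  rw [Finset.sum_add_distrib, Finset.sum_sub_distrib, ← Finset.sum_mul, ← Finset.mul_sum,
    ← Finset.mul_sum, ← frobSq_eq_sum_sqnorm, mul_div_cancel₀ _ hB.ne']
  rfl

lemma rkrrkStep_snd_mem_range {m l n : ℕ} (A : Matrix (Fin m) (Fin l) ℝ)
    (B : Matrix (Fin l) (Fin n) ℝ) (b : Fin m → ℝ) (γ : ℝ) (Df : (Fin n → ℝ) → (Fin n → ℝ))
    (c : Fin m × Fin l) {s : (Fin l → ℝ) × (Fin n → ℝ)} (hs : s.2 ∈ Set.range Bᵀ.mulVec) :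
    (rkrrkStep A B b γ Df c s).2 ∈ Set.range Bᵀ.mulVec := by
  obtain ⟨w, hw⟩ := hs
  refine ⟨w - (γ * (dotp (B c.2) (Df s.2) - (rkrrkStep A B b γ Df c s).1 c.2) /
    sqnorm (B c.2)) • Pi.single c.2 1, ?_⟩
  rw [Matrix.mulVec_sub, Matrix.mulVec_smul, hw, Matrix.mulVec_single_one]
  rfl

lemma rkrrkIter_snd_mem_range {m l n : ℕ} (A : Matrix (Fin m) (Fin l) ℝ)
    (B : Matrix (Fin l) (Fin n) ℝ) (b : Fin m → ℝ) (γ : ℝ) (Df : (Fin n → ℝ) → (Fin n → ℝ))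
    (y0 : Fin l → ℝ) {z0 : Fin n → ℝ} (hz0 : z0 ∈ Set.range Bᵀ.mulVec)
    (cs : List (Fin m × Fin l)) :
    (rkrrkIter A B b γ Df y0 z0 cs).2 ∈ Set.range Bᵀ.mulVec := by
  induction cs with
  | nil => exact hz0
  | cons c cs ih => exact rkrrkStep_snd_mem_range A B b γ Df c ih

/-- The last index choice can be averaged first. -/
lemma sum_rkrrkIter_succ {m l n : ℕ} (A : Matrix (Fin m) (Fin l) ℝ)
    (B : Matrix (Fin l) (Fin n) ℝ) (b : Fin m → ℝ) (γ : ℝ) (Df : (Fin n → ℝ) → (Fin n → ℝ))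
    (y0 : Fin l → ℝ) (z0 : Fin n → ℝ) (p : Fin m × Fin l → ℝ)
    (g : (Fin l → ℝ) × (Fin n → ℝ) → ℝ) (k : ℕ) :
    ∑ s : Fin (k + 1) → Fin m × Fin l,
        (∏ t, p (s t)) * g (rkrrkIter A B b γ Df y0 z0 (List.ofFn s))
      = ∑ s : Fin k → Fin m × Fin l, (∏ t, p (s t)) *
          ∑ c, p c * g (rkrrkStep A B b γ Df c (rkrrkIter A B b γ Df y0 z0 (List.ofFn s))) := by
  rw [← (Fin.consEquiv fun _ => Fin m × Fin l).sum_comp, Fintype.sum_prod_type_right]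
  refine Finset.sum_congr rfl fun s _ => ?_
  rw [Finset.mul_sum]
  refine Finset.sum_congr rfl fun c _ => ?_
  simp only [Fin.consEquiv_apply, Fin.prod_univ_succ, Fin.cons_zero, Fin.cons_succ,
    List.ofFn_succ, rkrrkIter]
  ring

/-- If one averaged step maps each `V a` below `ρ • V (a + c)` on an invariant set containing the
iterates, then `k` averaged steps map `V a` below `ρ ^ k • V (a + k c)`. -/
lemma sum_rkrrkIter_le {m l n : ℕ} (A : Matrix (Fin m) (Fin l) ℝ)
    (B : Matrix (Fin l) (Fin n) ℝ) (b : Fin m → ℝ) (γ : ℝ) (Df : (Fin n → ℝ) → (Fin n → ℝ))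
    (y0 : Fin l → ℝ) {z0 : Fin n → ℝ} (hz0 : z0 ∈ Set.range Bᵀ.mulVec)
    (p : Fin m × Fin l → ℝ) (hp : ∀ c, 0 ≤ p c)
    (V : ℝ → (Fin l → ℝ) × (Fin n → ℝ) → ℝ) {ρ c : ℝ} (hρ : 0 ≤ ρ) (hc : 0 ≤ c)
    (hV : ∀ a, 0 ≤ a → ∀ σ : (Fin l → ℝ) × (Fin n → ℝ), σ.2 ∈ Set.range Bᵀ.mulVec →
      ∑ i, p i * V a (rkrrkStep A B b γ Df i σ) ≤ ρ * V (a + c) σ)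
    (k : ℕ) (a : ℝ) (ha : 0 ≤ a) :
    ∑ s : Fin k → Fin m × Fin l,
        (∏ t, p (s t)) * V a (rkrrkIter A B b γ Df y0 z0 (List.ofFn s))
      ≤ ρ ^ k * V (a + k * c) (y0, z0) := by
  induction k generalizing a with
  | zero => simp [rkrrkIter]
  | succ k ih =>
    rw [sum_rkrrkIter_succ]
    calc _ ≤ ∑ s : Fin k → Fin m × Fin l, (∏ t, p (s t)) *
            (ρ * V (a + c) (rkrrkIter A B b γ Df y0 z0 (List.ofFn s))) := by
          refine Finset.sum_le_sum fun s _ => mul_le_mul_of_nonneg_left ?_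
            (Finset.prod_nonneg fun t _ => hp _)
          exact hV a ha _ (rkrrkIter_snd_mem_range A B b γ Df y0 hz0 _)
      _ = ρ * ∑ s : Fin k → Fin m × Fin l, (∏ t, p (s t)) *
            V (a + c) (rkrrkIter A B b γ Df y0 z0 (List.ofFn s)) := by
          rw [Finset.mul_sum]
          exact Finset.sum_congr rfl fun s _ => by ring
      _ ≤ ρ * (ρ ^ k * V (a + c + k * c) (y0, z0)) :=
          mul_le_mul_of_nonneg_left (ih (a + c) (by positivity)) hρ
      _ = ρ ^ (k + 1) * V (a + (k + 1 : ℕ) * c) (y0, z0) := by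
          rw [show a + c + k * c = a + (k + 1 : ℕ) * c by push_cast; ring]
          ring

/-- The averaged one-step estimate for the Bregman distance plus a multiple of the squared error
of the auxiliary iterate. -/
lemma sum_rkrrkStep_le {m l n : ℕ} (A : Matrix (Fin m) (Fin l) ℝ)
    (B : Matrix (Fin l) (Fin n) ℝ) (b : Fin m → ℝ) (hA : 0 < frobSq A) (hB : 0 < frobSq B)
    {f : (Fin n → ℝ) → ℝ} {γ : ℝ} (hγ : 0 < γ) (hsc : StrongConvexWith γ f)
    (Df : (Fin n → ℝ) → (Fin n → ℝ)) (hDf : ∀ x z, z ∈ subdiff f x ↔ x = Df z)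
    (w : Fin n → ℝ) (hfeas : A.mulVec (B.mulVec w) = b) {ν : ℝ} (hν : 0 < ν)
    (hnu : ∀ x z, z ∈ subdiff f x → z ∈ Set.range Bᵀ.mulVec →
      Dbreg f z x w ≤ (1 / ν) * sqnorm (B.mulVec (x - w)))
    {ρ : ℝ} (hα : 1 - sminSq A / frobSq A ≤ ρ) (hβ : 1 - γ * ν / (2 * frobSq B) ≤ ρ)
    {a : ℝ} (ha : 0 ≤ a) (σ : (Fin l → ℝ) × (Fin n → ℝ)) (hσ : σ.2 ∈ Set.range Bᵀ.mulVec) :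
    ∑ c : Fin m × Fin l, sqnorm (A c.1) / frobSq A * (sqnorm (B c.2) / frobSq B) *
        (Dbreg f (rkrrkStep A B b γ Df c σ).2 (Df (rkrrkStep A B b γ Df c σ).2) w
          + a * sqnorm ((rkrrkStep A B b γ Df c σ).1 - B.mulVec w))
      ≤ ρ * (Dbreg f σ.2 (Df σ.2) w
          + (a + γ / (2 * frobSq B)) * sqnorm (σ.1 - B.mulVec w)) := by
  obtain ⟨y, z⟩ := σ
  dsimp only at hσ ⊢
  have hz : z ∈ subdiff f (Df z) := (hDf _ _).2 rfl
  set D := Dbreg f z (Df z) w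
  set C := γ / (2 * frobSq B) with hC
  have hC0 : 0 ≤ C := by positivity
  set Y : Fin m → Fin l → ℝ := fun j => y - ((dotp (A j) y - b j) / sqnorm (A j)) • A j
  have hpB : ∑ i, sqnorm (B i) / frobSq B = 1 := by
    rw [← Finset.sum_div, ← frobSq_eq_sum_sqnorm, div_self hB.ne']
  have hpA : ∑ j, sqnorm (A j) / frobSq A = 1 := by
    rw [← Finset.sum_div, ← frobSq_eq_sum_sqnorm, div_self hA.ne']
  have hD0 : 0 ≤ D := Dbreg_nonneg hz w
  have hdec : D - C * sqnorm (B.mulVec (Df z - w)) ≤ ρ * D := by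
    have h1 := hnu _ z hz hσ
    rw [one_div, ← div_eq_inv_mul, le_div_iff₀ hν] at h1
    have h2 := mul_le_mul_of_nonneg_left h1 hC0
    have h3 := mul_le_mul_of_nonneg_right hβ hD0
    have h4 : (1 - γ * ν / (2 * frobSq B)) * D = D - C * (D * ν) := by rw [hC]; ring
    linarith
  have hrow (j : Fin m) : ∑ i, sqnorm (A j) / frobSq A * (sqnorm (B i) / frobSq B) *
      (Dbreg f (rkrrkStep A B b γ Df (j, i) (y, z)).2
          (Df (rkrrkStep A B b γ Df (j, i) (y, z)).2) w
        + a * sqnorm ((rkrrkStep A B b γ Df (j, i) (y, z)).1 - B.mulVec w))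
      ≤ sqnorm (A j) / frobSq A * (ρ * D)
        + (a + C) * (sqnorm (A j) / frobSq A * sqnorm (Y j - B.mulVec w)) := by
    have hstep := sum_Dbreg_step_le B hB hγ hsc Df hDf w z (Y j)
    have hpj : 0 ≤ sqnorm (A j) / frobSq A := div_nonneg (sqnorm_nonneg _) hA.le
    calc _ = sqnorm (A j) / frobSq A * (∑ i, sqnorm (B i) / frobSq B *
            Dbreg f (z - (γ * (dotp (B i) (Df z) - Y j i) / sqnorm (B i)) • B i)
              (Df (z - (γ * (dotp (B i) (Df z) - Y j i) / sqnorm (B i)) • B i)) w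
            + (∑ i, sqnorm (B i) / frobSq B) * (a * sqnorm (Y j - B.mulVec w))) := by
          rw [Finset.sum_mul, ← Finset.sum_add_distrib, Finset.mul_sum]
          refine Finset.sum_congr rfl fun i _ => ?_
          rw [← mul_add, mul_assoc]
          rfl
      _ ≤ sqnorm (A j) / frobSq A *
            ((ρ * D + C * sqnorm (Y j - B.mulVec w)) + 1 * (a * sqnorm (Y j - B.mulVec w))) := by
          rw [hpB]
          gcongr
          linarith
      _ = _ := by ring
  rw [Fintype.sum_prod_type]
  refine (Finset.sum_le_sum fun j _ => hrow j).trans ?_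
  rw [Finset.sum_add_distrib, ← Finset.sum_mul, hpA, ← Finset.mul_sum, one_mul]
  have hK := sum_sqnorm_kaczmarz_step_le A hA y (B.mulVec w)
  rw [hfeas] at hK
  have hK' := hK.trans (mul_le_mul_of_nonneg_right hα (sqnorm_nonneg _))
  have := mul_le_mul_of_nonneg_left hK' (add_nonneg ha hC0)
  calc _ ≤ ρ * D + (a + C) * (ρ * sqnorm (y - B.mulVec w)) := by gcongr
    _ = _ := by ring

lemma nat_mul_sq_le_one_add_pow {t : ℝ} (ht : 0 ≤ t) (k : ℕ) :
    k * t ^ 2 ≤ (1 + t) ^ (k + 1) := by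
  induction k with
  | zero => simpa using by linarith
  | succ k ih =>
    have h1 : 1 + t ≤ (1 + t) ^ (k + 1) := le_self_pow₀ (by linarith) (by omega)
    have h2 := mul_le_mul_of_nonneg_left h1 ht
    rw [pow_succ (1 + t) (k + 1)]
    push_cast
    nlinarith

/-- Linear convergence of RK-RRK in the squared Euclidean error
(Remark 3.2): with `ρ = max{α, β}` and `(1 + δ/γ)ρ < 1`, the expected squared
distance of the `k`-th RK-RRK primal iterate `x^{(k)} = Df z^{(k)}` to `x⋆` is
bounded by `(1+δ/γ)^k ρ^k (2/γ)(D_{f,z⁰}(x⁰,x⋆) + ((δ+γ)γ²/(2δ²‖B‖_F²))‖A†b‖₂²)`;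
in particular RK-RRK converges linearly in expectation to `x⋆` with rate `(1+δ/γ)ρ`. -/
theorem rk_rrk_linear_rate_error {m l n : ℕ}
    (A : Matrix (Fin m) (Fin l) ℝ) (B : Matrix (Fin l) (Fin n) ℝ)
    (b : Fin m → ℝ) (Adag : Matrix (Fin l) (Fin m) ℝ)
    (hA : A.rank = l) (hB : B.rank = l) (hAdag : IsMoorePenrose A Adag)
    (hb : ∃ x, (A * B).mulVec x = b)
    (f : (Fin n → ℝ) → ℝ) (γ : ℝ) (hγ : 0 < γ) (hsc : StrongConvexWith γ f)
    (Df : (Fin n → ℝ) → (Fin n → ℝ)) (hDf : ∀ x z, z ∈ subdiff f x ↔ x = Df z)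
    (xstar : Fin n → ℝ) (hfeas : (A * B).mulVec xstar = b)
    (hmin : ∀ x, (A * B).mulVec x = b → f xstar ≤ f x)
    (ν : ℝ) (hν : 0 < ν)
    (hnu : ∀ x z, z ∈ subdiff f x → z ∈ Set.range Bᵀ.mulVec →
      Dbreg f z x xstar ≤ (1 / ν) * sqnorm (B.mulVec (x - xstar)))
    (z0 : Fin n → ℝ) (hz0 : z0 ∈ Set.range Bᵀ.mulVec)
    (δ : ℝ) (hδ : 0 < δ)
    (ρ : ℝ) (hρ : ρ = max (1 - sminSq A / frobSq A) (1 - γ * ν / (2 * frobSq B)))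
    (hrate : (1 + δ / γ) * ρ < 1)
    (k : ℕ) (hk : 1 ≤ k) :
    ∑ s : Fin k → Fin m × Fin l,
        (∏ t, (sqnorm (A (s t).1) / frobSq A) * (sqnorm (B (s t).2) / frobSq B)) *
          sqnorm (Df (rkrrkIter A B b γ Df 0 z0 (List.ofFn s)).2 - xstar)
      ≤ (1 + δ / γ) ^ k * ρ ^ k * (2 / γ) *
          (Dbreg f z0 (Df z0) xstar +
            (δ + γ) * γ ^ 2 / (2 * δ ^ 2 * frobSq B) * sqnorm (Adag.mulVec b)) := by
  have hl : 0 < l := by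
    rcases Nat.eq_zero_or_pos l with rfl | h
    · have h1 : (1 : ℝ) ≤ ρ := by
        rw [hρ]
        exact le_max_of_le_left (by simp [frobSq])
      have h2 : 0 < δ / γ := by positivity
      nlinarith
    · exact h
  have hFA := frobSq_pos A (ne_zero_of_rank_pos A (hA.symm ▸ hl))
  have hFB := frobSq_pos B (ne_zero_of_rank_pos B (hB.symm ▸ hl))
  have hα : 1 - sminSq A / frobSq A ≤ ρ := hρ ▸ le_max_left _ _
  have hβ : 1 - γ * ν / (2 * frobSq B) ≤ ρ := hρ ▸ le_max_right _ _
  have hρ0 : 0 ≤ ρ := by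
    have := sminSq_div_frobSq_le_one A hFA hl
    linarith
  have hsub : ∀ z, z ∈ subdiff f (Df z) := fun z => (hDf _ _).2 rfl
  have hAy : A.mulVec (B.mulVec xstar) = b := by rw [Matrix.mulVec_mulVec, hfeas]
  have hdag : Adag.mulVec b = B.mulVec xstar := by
    apply mulVec_injective_of_rank_eq A hA
    rw [← hAy, Matrix.mulVec_mulVec, Matrix.mulVec_mulVec, hAdag.1]
  have hp (c : Fin m × Fin l) :
      0 ≤ sqnorm (A c.1) / frobSq A * (sqnorm (B c.2) / frobSq B) :=
    mul_nonneg (div_nonneg (sqnorm_nonneg _) hFA.le) (div_nonneg (sqnorm_nonneg _) hFB.le)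
  have hmain := sum_rkrrkIter_le A B b γ Df 0 hz0
    (fun c => sqnorm (A c.1) / frobSq A * (sqnorm (B c.2) / frobSq B)) hp
    (fun a σ => Dbreg f σ.2 (Df σ.2) xstar + a * sqnorm (σ.1 - B.mulVec xstar))
    hρ0 (c := γ / (2 * frobSq B)) (by positivity)
    (fun a ha σ hσ => sum_rkrrkStep_le A B b hFA hFB hγ hsc Df hDf xstar hAy hν hnu hα hβ ha σ hσ)
    k 0 le_rfl
  have hneg : sqnorm (0 - B.mulVec xstar) = sqnorm (B.mulVec xstar) := by simp [sqnorm]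
  simp only [zero_mul, add_zero, zero_add, hneg] at hmain
  rw [hdag]
  set D := Dbreg f z0 (Df z0) xstar
  set N := sqnorm (B.mulVec xstar)
  have hD0 : 0 ≤ D := Dbreg_nonneg (hsub z0) xstar
  have hN0 : 0 ≤ N := sqnorm_nonneg _
  have ht : 0 < δ / γ := by positivity
  have hcoef : k * (γ / (2 * frobSq B))
      ≤ (1 + δ / γ) ^ k * ((δ + γ) * γ ^ 2 / (2 * δ ^ 2 * frobSq B)) := by
    have h := nat_mul_sq_le_one_add_pow ht.le k
    have hq : 0 ≤ γ ^ 3 / (2 * δ ^ 2 * frobSq B) := by positivity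
    calc k * (γ / (2 * frobSq B))
        = k * (δ / γ) ^ 2 * (γ ^ 3 / (2 * δ ^ 2 * frobSq B)) := by field_simp
      _ ≤ (1 + δ / γ) ^ (k + 1) * (γ ^ 3 / (2 * δ ^ 2 * frobSq B)) := by gcongr
      _ = _ := by
        rw [pow_succ, mul_assoc]
        congr 1
        field_simp
        ring
  have hfinal : D + k * (γ / (2 * frobSq B)) * N
      ≤ (1 + δ / γ) ^ k * (D + (δ + γ) * γ ^ 2 / (2 * δ ^ 2 * frobSq B) * N) := by
    have h1 : D ≤ (1 + δ / γ) ^ k * D :=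
      le_mul_of_one_le_left hD0 (one_le_pow₀ (by linarith))
    have h2 := mul_le_mul_of_nonneg_right hcoef hN0
    linarith
  calc _ ≤ ∑ s : Fin k → Fin m × Fin l,
        (∏ t, (sqnorm (A (s t).1) / frobSq A) * (sqnorm (B (s t).2) / frobSq B)) *
          (2 / γ * Dbreg f (rkrrkIter A B b γ Df 0 z0 (List.ofFn s)).2
            (Df (rkrrkIter A B b γ Df 0 z0 (List.ofFn s)).2) xstar) := by
        refine Finset.sum_le_sum fun s _ => mul_le_mul_of_nonneg_left ?_
          (Finset.prod_nonneg fun t _ => hp _)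
        exact sqnorm_sub_le_Dbreg hγ hsc (hsub _) xstar
    _ = 2 / γ * ∑ s : Fin k → Fin m × Fin l,
        (∏ t, (sqnorm (A (s t).1) / frobSq A) * (sqnorm (B (s t).2) / frobSq B)) *
          Dbreg f (rkrrkIter A B b γ Df 0 z0 (List.ofFn s)).2
            (Df (rkrrkIter A B b γ Df 0 z0 (List.ofFn s)).2) xstar := by
        rw [Finset.mul_sum]
        exact Finset.sum_congr rfl fun s _ => by ring
    _ ≤ 2 / γ * (ρ ^ k *
        ((1 + δ / γ) ^ k * (D + (δ + γ) * γ ^ 2 / (2 * δ ^ 2 * frobSq B) * N))) := by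
        refine mul_le_mul_of_nonneg_left (hmain.trans ?_) (by positivity)
        exact mul_le_mul_of_nonneg_left hfinal (by positivity)
    _ = _ := by ring

end
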